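/- Let p ∈ (1,∞) and let d ≥ 3 be an integer. Then there exists c = c(p,d) > 1 such that for every norm ‖·‖ on ℝ^d satisfying ‖x‖ ≤ ‖x‖_p ≤ c‖x‖ for all x ∈ ℝ^d, the space X = (ℝ^d, ‖·‖) satisfies m(X) ≤ d+1. -/

import Mathlib

/-- `N` is a norm on `ℝ^d`. -/
structure IsNorm {d : ℕ} (N : (Fin d → ℝ) → ℝ) : Prop where
  eq_zero_iff : ∀ x, N x = 0 ↔ x = 0
  smul : ∀ (c : ℝ) (x), N (c • x) = |c| * N x
  add_le : ∀ x y, N (x + y) ≤ N x + N y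

/-- A set `A ⊆ ℝ^d` is `lam`-equilateral with respect to the norm `N` if `lam > 0` and
the `N`-distance between any two distinct points of `A` equals `lam`. -/
def NEquilateralWith {d : ℕ} (N : (Fin d → ℝ) → ℝ) (A : Set (Fin d → ℝ)) (lam : ℝ) : Prop :=
  0 < lam ∧ A.Pairwise fun x y => N (x - y) = lam

/-- A set is equilateral w.r.t. `N` if it is `lam`-equilateral for some `lam > 0`. -/
def NEquilateral {d : ℕ} (N : (Fin d → ℝ) → ℝ) (A : Set (Fin d → ℝ)) : Prop :=
  ∃ lam : ℝ, NEquilateralWith N A lam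

/-- An equilateral set w.r.t. `N` is maximal if it is not properly contained in any
set equilateral w.r.t. `N`. -/
def NMaximalEquilateral {d : ℕ} (N : (Fin d → ℝ) → ℝ) (A : Set (Fin d → ℝ)) : Prop :=
  NEquilateral N A ∧ ∀ B : Set (Fin d → ℝ), NEquilateral N B → A ⊆ B → B = A

theorem strictConvexOn_abs_rpow {p : ℝ} (hp : 1 < p) :
    StrictConvexOn ℝ Set.univ fun x : ℝ => |x| ^ p := by
  refine ⟨convex_univ, fun x _ y _ hxy a b ha hb hab => ?_⟩
  have hp0 : 0 < p := by linarith
  simp only [smul_eq_mul]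
  have htri : |a * x + b * y| ≤ a * |x| + b * |y| := by
    simpa [abs_mul, abs_of_pos ha, abs_of_pos hb] using abs_add_le (a * x) (b * y)
  by_cases h : |x| = |y|
  · rcases abs_eq_abs.1 h with h' | h'
    · exact absurd h' hxy
    · have hy : y ≠ 0 := by rintro rfl; simp_all
      have hlt : |a * x + b * y| < |y| := by
        have : a * x + b * y = (b - a) * y := by rw [h']; ring
        rw [this, abs_mul]
        have : |b - a| < 1 := abs_lt.2 ⟨by linarith, by linarith⟩
        nlinarith [abs_pos.2 hy]
      calc |a * x + b * y| ^ p < |y| ^ p := Real.rpow_lt_rpow (abs_nonneg _) hlt hp0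
        _ = a * |x| ^ p + b * |y| ^ p := by rw [h, ← add_mul, hab, one_mul]
  · exact (Real.rpow_le_rpow (abs_nonneg _) htri hp0.le).trans_lt
      ((strictConvexOn_rpow hp).2 (abs_nonneg x) (abs_nonneg y) h ha hb hab)

theorem strictAnti_abs_sub_one_rpow_sub {p : ℝ} (hp : 1 < p) :
    StrictAnti fun x : ℝ => |x - 1| ^ p - |x| ^ p := by
  intro s t hst
  have hD : 0 < t - s + 1 := by linarith
  have hne : s - 1 ≠ t := by linarith
  have ha : 0 < (t - s) / (t - s + 1) := div_pos (by linarith) hD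
  have hb : 0 < 1 / (t - s + 1) := by positivity
  have hab : (t - s) / (t - s + 1) + 1 / (t - s + 1) = 1 := by field_simp
  have h1 := (strictConvexOn_abs_rpow hp).2 (Set.mem_univ (s - 1)) (Set.mem_univ t) hne ha hb hab
  have h2 := (strictConvexOn_abs_rpow hp).2 (Set.mem_univ (s - 1)) (Set.mem_univ t) hne hb ha
    ((add_comm _ _).trans hab)
  simp only [smul_eq_mul] at h1 h2
  rw [show (t - s) / (t - s + 1) * (s - 1) + 1 / (t - s + 1) * t = s by field_simp; ring] at h1
  rw [show 1 / (t - s + 1) * (s - 1) + (t - s) / (t - s + 1) * t = t - 1 by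
    field_simp; ring] at h2
  have h3 : (t - s) / (t - s + 1) = 1 - 1 / (t - s + 1) := by linarith
  rw [h3] at h1 h2
  simp only
  linarith

theorem five_rpow_add_le {p : ℝ} (hp : 1 < p) (hp2 : p ≤ 2) :
    (5 : ℝ) ^ p + 2 * 2 ^ p ≤ 2 * 4 ^ p + 1 := by
  have hderiv : ∀ u ∈ Set.Icc (0 : ℝ) 1, HasDerivAt
      (fun u : ℝ => (3 + 2 * u) ^ p - (3 - 2 * u) ^ p - 2 * ((3 + u) ^ p - (3 - u) ^ p))
      (2 * p * ((3 + 2 * u) ^ (p - 1) + (3 - 2 * u) ^ (p - 1)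
        - ((3 + u) ^ (p - 1) + (3 - u) ^ (p - 1)))) u := by
    intro u hu
    have hp1 : 1 ≤ p := hp.le
    have l1 : HasDerivAt (fun u : ℝ => 3 + 2 * u) 2 u := by
      simpa using ((hasDerivAt_id u).const_mul 2).const_add 3
    have l2 : HasDerivAt (fun u : ℝ => 3 - 2 * u) (-2) u := by
      simpa using ((hasDerivAt_id u).const_mul 2).const_sub 3
    have l3 : HasDerivAt (fun u : ℝ => 3 + u) 1 u := by
      simpa using (hasDerivAt_id u).const_add 3
    have l4 : HasDerivAt (fun u : ℝ => 3 - u) (-1) u := by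
      simpa using (hasDerivAt_id u).const_sub 3
    exact (((l1.rpow_const (p := p) (Or.inr hp1)).sub (l2.rpow_const (Or.inr hp1))).sub
      (((l3.rpow_const (p := p) (Or.inr hp1)).sub
        (l4.rpow_const (p := p) (Or.inr hp1))).const_mul 2)).congr_deriv (by ring)
  have hanti : AntitoneOn
      (fun u : ℝ => (3 + 2 * u) ^ p - (3 - 2 * u) ^ p - 2 * ((3 + u) ^ p - (3 - u) ^ p))
      (Set.Icc 0 1) := by
    refine antitoneOn_of_deriv_nonpos (convex_Icc 0 1)
      (fun u hu => (hderiv u hu).continuousAt.continuousWithinAt)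
      (fun u hu => (hderiv u (interior_subset hu)).differentiableAt.differentiableWithinAt) ?_
    intro u hu
    have hu' := interior_subset hu
    rw [(hderiv u hu').deriv]
    obtain ⟨h0, h1⟩ := hu'
    have hc := (Real.concaveOn_rpow (p := p - 1) (by linarith) (by linarith)).2
    have hx : (3 + 2 * u) ∈ Set.Ici (0 : ℝ) := by simp; linarith
    have hy : (3 - 2 * u) ∈ Set.Ici (0 : ℝ) := by simp; linarith
    have c1 := hc hx hy (a := 3 / 4) (b := 1 / 4) (by norm_num) (by norm_num) (by norm_num)
    have c2 := hc hx hy (a := 1 / 4) (b := 3 / 4) (by norm_num) (by norm_num) (by norm_num)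
    simp only [smul_eq_mul] at c1 c2
    rw [show 3 / 4 * (3 + 2 * u) + 1 / 4 * (3 - 2 * u) = 3 + u by ring] at c1
    rw [show 1 / 4 * (3 + 2 * u) + 3 / 4 * (3 - 2 * u) = 3 - u by ring] at c2
    exact mul_nonpos_of_nonneg_of_nonpos (by linarith) (by linarith)
  have h := hanti (Set.left_mem_Icc.2 zero_le_one) (Set.right_mem_Icc.2 zero_le_one) zero_le_one
  norm_num at h
  linarith

/-- No two points on the diagonal of `ℝ^d` extend the standard basis to an equilateral set
for the `p`-norm. -/
theorem diagonal_extension_false {p : ℝ} (hp : 1 < p) {d : ℝ} (hd : 3 ≤ d) {a b : ℝ}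
    (hlt : b < a) (ha : |a - 1| ^ p + (d - 1) * |a| ^ p = 2)
    (hb : |b - 1| ^ p + (d - 1) * |b| ^ p = 2) (hab : d * (a - b) ^ p = 2) : False := by
  have hp0 : 0 < p := by linarith
  set f : ℝ → ℝ := fun t => |t - 1| ^ p + (d - 1) * |t| ^ p with hf
  have hconv := (strictConvexOn_abs_rpow hp).convexOn.2
  have below : ∀ y θ : ℝ, f y ≤ 2 → 0 ≤ θ → θ < 1 → f (θ * y) < 2 := by
    intro y θ hy h0 h1
    have c1 := hconv (Set.mem_univ (-1 : ℝ)) (Set.mem_univ (y - 1)) (sub_nonneg.2 h1.le) h0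
      (by ring)
    have c2 := hconv (Set.mem_univ (0 : ℝ)) (Set.mem_univ y) (sub_nonneg.2 h1.le) h0
      (by ring)
    simp only [smul_eq_mul, abs_neg, abs_one, Real.one_rpow, abs_zero,
      Real.zero_rpow hp0.ne', mul_zero, zero_add, mul_one] at c1 c2
    rw [show (1 - θ) * -1 + θ * (y - 1) = θ * y - 1 by ring] at c1
    have c3 := mul_le_mul_of_nonneg_left c2 (by linarith : 0 ≤ d - 1)
    simp only [hf] at hy ⊢
    nlinarith
  have below_pos : ∀ x y : ℝ, 0 ≤ x → x < y → f y ≤ 2 → f x < 2 := by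
    intro x y h0 hxy hy
    have hy0 : 0 < y := by linarith
    have := below y (x / y) hy (by positivity) ((div_lt_one hy0).2 hxy)
    rwa [div_mul_cancel₀ _ hy0.ne'] at this
  have below_neg : ∀ x y : ℝ, x ≤ 0 → y < x → f y ≤ 2 → f x < 2 := by
    intro x y h0 hxy hy
    have hy0 : y < 0 := by linarith
    have := below y (x / y) hy (div_nonneg_of_nonpos h0 hy0.le)
      ((div_lt_one_of_neg hy0).2 hxy)
    rwa [div_mul_cancel₀ _ hy0.ne] at this
  change f a = 2 at ha
  change f b = 2 at hb
  have hb0 : b < 0 := by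
    by_contra! h
    exact (below_pos b a h hlt ha.le).ne hb
  have ha0 : 0 < a := by
    by_contra! h
    exact (below_neg a b h hlt hb.le).ne ha
  obtain ⟨s, hs⟩ : ∃ s, s = a - b := ⟨_, rfl⟩
  rw [← hs] at hab
  have hs0 : 0 < s := by linarith
  by_cases hhalf : 1 / 2 ≤ a
  · have h1 : |a - 1| ^ p ≤ a ^ p :=
      Real.rpow_le_rpow (abs_nonneg _) (abs_le.2 ⟨by linarith, by linarith⟩) hp0.le
    have h2 : a ^ p < s ^ p := Real.rpow_lt_rpow ha0.le (by linarith) hp0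
    simp only [hf, abs_of_pos ha0] at ha
    nlinarith
  push Not at hhalf
  have hhalf' : 2 < f (1 / 2) := by
    by_contra! h
    exact (below_pos a _ ha0.le hhalf h).ne ha
  have hdhalf : 2 < d * (1 / 2) ^ p := by
    have : f (1 / 2) = d * (1 / 2) ^ p := by
      simp only [hf]
      rw [show |(1 / 2 : ℝ) - 1| = 1 / 2 by norm_num [abs_of_neg],
        show |(1 / 2 : ℝ)| = 1 / 2 by norm_num]
      ring
    linarith
  have hs_half : s < 1 / 2 := by
    by_contra! h
    have := Real.rpow_le_rpow (by norm_num) h hp0.le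
    nlinarith
  rcases le_total p 2 with hp2 | hp2
  · have hmono : (1 + s / 2) ^ p - (s / 2) ^ p ≤ (5 / 4) ^ p - (1 / 4) ^ p := by
      have := (strictAnti_abs_sub_one_rpow_sub hp).antitone
        (show 1 + s / 2 ≤ 5 / 4 by linarith)
      rw [show 1 + s / 2 - 1 = s / 2 by ring, abs_of_pos (by linarith : 0 < s / 2),
        abs_of_pos (by linarith : 0 < 1 + s / 2)] at this
      norm_num [abs_of_pos] at this ⊢
      linarith
    have hquarter : (5 / 4 : ℝ) ^ p - (1 / 4) ^ p + 2 * (1 / 2) ^ p ≤ 2 := by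
      have h5 := five_rpow_add_le hp hp2
      have h4 : (0 : ℝ) < 4 ^ p := by positivity
      rw [show (1 / 2 : ℝ) = 2 / 4 by norm_num]
      rw [Real.div_rpow (by norm_num) (by norm_num), Real.div_rpow (by norm_num) (by norm_num),
        Real.div_rpow (by norm_num) (by norm_num), Real.one_rpow, ← sub_div,
        mul_div_assoc', ← add_div, div_le_iff₀ h4]
      linarith
    have hs2 : d * (s / 2) ^ p = 2 * (1 / 2) ^ p := by
      rw [show s / 2 = s * (1 / 2) by ring, Real.mul_rpow hs0.le (by norm_num), ← hab]
      ring
    have hneg : f (-(s / 2)) ≤ 2 := by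
      simp only [hf]
      rw [abs_neg, abs_of_pos (by linarith : 0 < s / 2),
        show -(s / 2) - 1 = -(1 + s / 2) by ring, abs_neg,
        abs_of_pos (by linarith : 0 < 1 + s / 2)]
      linarith
    have hpos : f (s / 2) < 2 := by
      refine lt_of_lt_of_le ?_ hneg
      simp only [hf]
      rw [abs_neg]
      have : |s / 2 - 1| < |-(s / 2) - 1| := by
        rw [abs_of_neg (by linarith), abs_of_neg (by linarith)]; linarith
      have := Real.rpow_lt_rpow (abs_nonneg _) this hp0
      linarith
    have hb2 : b ≤ -(s / 2) := by
      by_contra! h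
      exact (below_neg b _ hb0.le h hneg).ne hb
    have ha2 : s / 2 < a := by
      by_contra! h
      rcases h.eq_or_lt with h | h
      · rw [h] at ha; linarith
      · exact (below_pos a _ ha0.le h hpos.le).ne ha
    linarith
  · obtain ⟨r, hr⟩ : ∃ r : ℝ, r = (1 / 2 : ℝ) ^ (1 / p) := ⟨_, rfl⟩
    have hr0 : 0 < r := by rw [hr]; positivity
    have hr1 : r < 1 := by
      rw [hr]; exact Real.rpow_lt_one (by norm_num) (by norm_num) (by positivity)
    have hrp : r ^ p = 1 / 2 := by
      rw [hr, ← Real.rpow_mul (by norm_num)]; field_simp; simp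
    have hr2 : 1 / 2 ≤ r ^ 2 := by
      rw [← hrp, ← Real.rpow_natCast r 2]
      exact Real.rpow_le_rpow_of_exponent_ge hr0 hr1.le (by exact_mod_cast hp2)
    have hsr : 0 < s * r := by positivity
    have hsr1 : s * r < 1 := by nlinarith
    have hfa : f (s * r) < 2 := by
      simp only [hf]
      rw [abs_of_pos hsr, abs_of_neg (by linarith : s * r - 1 < 0),
        Real.mul_rpow hs0.le hr0.le, hrp]
      have h1 : (-(s * r - 1)) ^ p < 1 :=
        Real.rpow_lt_one (by linarith) (by linarith) hp0
      have h2 : 0 < s ^ p := by positivity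
      nlinarith
    have ha2 : s * r < a := by
      by_contra! h
      rcases h.eq_or_lt with h | h
      · rw [h] at ha; linarith
      · exact (below_pos a _ ha0.le h hfa.le).ne ha
    have hY : ((3 - r) / 2) ^ p ≤ √2 := by
      apply Real.le_sqrt_of_sq_le
      have hY0 : 0 < (3 - r) / 2 := by linarith
      have h1 : ((3 - r) / 2) ^ 2 * r ≤ 1 := by
        nlinarith [mul_nonneg (sq_nonneg (1 - r)) (by linarith : 0 ≤ 4 - r)]
      have h2 := Real.rpow_le_one (by positivity) h1 hp0.le
      rw [Real.mul_rpow (by positivity) hr0.le, hrp, ← Real.rpow_natCast, ← Real.rpow_mul hY0.le,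
        mul_comm, ← mul_comm p, Real.rpow_mul hY0.le, Real.rpow_natCast] at h2
      linarith
    have hr3 : (1 - r) ^ p ≤ 1 - √2 / 2 := by
      have h1 : (1 - r) ^ p ≤ (1 - r) ^ (1 : ℝ) :=
        Real.rpow_le_rpow_of_exponent_ge (by linarith) (by linarith) hp.le
      have h2 : √2 / 2 ≤ r := by
        refine (pow_le_pow_iff_left₀ (by positivity) hr0.le two_ne_zero).1 ?_
        rw [div_pow, Real.sq_sqrt (by norm_num)]; linarith
      rw [Real.rpow_one] at h1
      linarith
    have hneg : f (-(s * (1 - r))) ≤ 2 := by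
      have hpos : 0 < s * (1 - r) := mul_pos hs0 (by linarith)
      simp only [hf]
      rw [abs_neg, abs_of_pos hpos, show -(s * (1 - r)) - 1 = -(1 + s * (1 - r)) by ring, abs_neg,
        abs_of_pos (by linarith : 0 < 1 + s * (1 - r))]
      have h1 : (1 + s * (1 - r)) ^ p ≤ ((3 - r) / 2) ^ p :=
        Real.rpow_le_rpow (by linarith) (by nlinarith) hp0.le
      have h2 : 0 ≤ (s * (1 - r)) ^ p := by positivity
      have h3 : d * (s * (1 - r)) ^ p = 2 * (1 - r) ^ p := by
        rw [Real.mul_rpow hs0.le (by linarith), ← hab]; ring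
      linarith
    exact (below_neg b _ hb0.le (by linarith) hneg).ne hb

/-- The `p`-norm on `ℝ^d`. -/
noncomputable def pNorm {d : ℕ} (p : ℝ) (x : Fin d → ℝ) : ℝ :=
  (∑ i, |x i| ^ p) ^ (1 / p)

theorem pNorm_rpow {d : ℕ} {p : ℝ} (hp : 1 < p) (x : Fin d → ℝ) :
    pNorm p x ^ p = ∑ i, |x i| ^ p := by
  have : 0 ≤ ∑ i, |x i| ^ p := Finset.sum_nonneg fun i _ => by positivity
  rw [pNorm, ← Real.rpow_mul this, one_div_mul_cancel (by linarith), Real.rpow_one]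

theorem pNorm_nonneg {d : ℕ} (p : ℝ) (x : Fin d → ℝ) : 0 ≤ pNorm p x :=
  Real.rpow_nonneg (Finset.sum_nonneg fun i _ => by positivity) _

theorem norm_le_pNorm {d : ℕ} {p : ℝ} (hp : 1 < p) (x : Fin d → ℝ) : ‖x‖ ≤ pNorm p x := by
  refine (pi_norm_le_iff_of_nonneg (pNorm_nonneg p x)).2 fun i => ?_
  have hp0 : 0 < p := by linarith
  rw [← Real.rpow_le_rpow_iff (norm_nonneg _) (pNorm_nonneg p x) hp0, pNorm_rpow hp]
  exact Finset.single_le_sum (f := fun i => |x i| ^ p) (fun i _ => by positivity)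
    (Finset.mem_univ i)

theorem continuous_pNorm {d : ℕ} {p : ℝ} (hp : 1 < p) :
    Continuous (pNorm p : (Fin d → ℝ) → ℝ) := by
  have hp0 : 0 < p := by linarith
  refine Continuous.rpow_const ?_ fun _ => Or.inr (by positivity)
  exact continuous_finsetSum _ fun i _ =>
    (continuous_apply i).abs.rpow_const fun _ => Or.inr hp0.le

theorem sum_abs_single_sub_single_rpow {d : ℕ} {p : ℝ} (hp : 1 < p) {i j : Fin d} (hij : i ≠ j) :
    ∑ k, |(Pi.single i 1 - Pi.single j 1 : Fin d → ℝ) k| ^ p = 2 := by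
  have hp0 : p ≠ 0 := by linarith
  have : ∀ k, |(Pi.single i 1 - Pi.single j 1 : Fin d → ℝ) k| ^ p
      = (if k = i then 1 else 0) + (if k = j then 1 else 0) := by
    intro k
    by_cases hi : k = i
    · subst hi; simp [hij]
    · by_cases hj : k = j
      · subst hj; simp [hi]
      · simp [hi, hj, hp0]
  simp only [this, Finset.sum_add_distrib]
  norm_num

theorem pNorm_single_sub_single {d : ℕ} {p : ℝ} (hp : 1 < p) {i j : Fin d} (hij : i ≠ j) :
    pNorm p (Pi.single i 1 - Pi.single j 1 : Fin d → ℝ) = 2 ^ (1 / p) := by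
  rw [pNorm, sum_abs_single_sub_single_rpow hp hij]

/-- The difference of two coordinates. -/
def coordDiff {d : ℕ} (i j : Fin d) : (Fin d → ℝ) →L[ℝ] ℝ :=
  ContinuousLinearMap.proj (R := ℝ) (φ := fun _ : Fin d => ℝ) i - ContinuousLinearMap.proj j

@[simp]
theorem coordDiff_apply {d : ℕ} (i j : Fin d) (x : Fin d → ℝ) : coordDiff i j x = x i - x j := rfl

theorem hasStrictFDerivAt_pNorm {d : ℕ} {p : ℝ} (hp : 1 < p) {i j : Fin d} (hij : i ≠ j) :
    HasStrictFDerivAt (pNorm p : (Fin d → ℝ) → ℝ)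
      (((2 : ℝ) ^ (1 / p) / 2) • coordDiff i j)
      (Pi.single i 1 - Pi.single j 1) := by
  have hp0 : p ≠ 0 := by linarith
  have habs : ∀ t : ℝ, HasStrictDerivAt (fun x : ℝ => |x| ^ p) (p * |t| ^ (p - 2) * t) t :=
    fun t => (contDiff_norm_rpow (E := ℝ) hp).contDiffAt.hasStrictDerivAt'
      (hasDerivAt_abs_rpow t hp) one_ne_zero
  have hsum : HasStrictFDerivAt (fun x : Fin d → ℝ => ∑ k, |x k| ^ p)
      (∑ k, (p * |(Pi.single i 1 - Pi.single j 1 : Fin d → ℝ) k| ^ (p - 2)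
        * (Pi.single i 1 - Pi.single j 1 : Fin d → ℝ) k) •
          (ContinuousLinearMap.proj k : (Fin d → ℝ) →L[ℝ] ℝ))
      (Pi.single i 1 - Pi.single j 1) :=
    HasStrictFDerivAt.fun_sum fun k _ => (habs _).comp_hasStrictFDerivAt _
      (ContinuousLinearMap.proj (R := ℝ) (φ := fun _ : Fin d => ℝ) k).hasStrictFDerivAt
  have hcoef : ∀ k, p * |(Pi.single i 1 - Pi.single j 1 : Fin d → ℝ) k| ^ (p - 2)
        * (Pi.single i 1 - Pi.single j 1 : Fin d → ℝ) k
      = (if k = i then p else 0) - (if k = j then p else 0) := by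
    intro k
    by_cases hi : k = i
    · subst hi; simp [hij]
    · by_cases hj : k = j
      · subst hj; simp [hi]
      · simp [hi, hj]
  have hroot := Real.hasStrictDerivAt_rpow_const (x := ∑ k,
    |(Pi.single i 1 - Pi.single j 1 : Fin d → ℝ) k| ^ p) (p := 1 / p)
    (Or.inl (by rw [sum_abs_single_sub_single_rpow hp hij]; norm_num))
  have h := hroot.comp_hasStrictFDerivAt (f := fun x : Fin d → ℝ => ∑ k, |x k| ^ p)
    (Pi.single i 1 - Pi.single j 1) hsum
  refine h.congr_fderiv ?_
  rw [sum_abs_single_sub_single_rpow hp hij, Real.rpow_sub_one two_ne_zero]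
  simp only [hcoef]
  ext x
  simp [sub_mul, Finset.sum_sub_distrib]
  field_simp

theorem IsNorm.neg {d : ℕ} {N : (Fin d → ℝ) → ℝ} (hN : IsNorm N) (x : Fin d → ℝ) :
    N (-x) = N x := by
  simpa using hN.smul (-1) x

theorem IsNorm.sub_comm {d : ℕ} {N : (Fin d → ℝ) → ℝ} (hN : IsNorm N) (x y : Fin d → ℝ) :
    N (x - y) = N (y - x) := by
  rw [← hN.neg, neg_sub]

theorem IsNorm.nonneg {d : ℕ} {N : (Fin d → ℝ) → ℝ} (hN : IsNorm N) (x : Fin d → ℝ) :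
    0 ≤ N x := by
  have h := hN.add_le x (-x)
  rw [hN.neg, add_neg_cancel, (hN.eq_zero_iff 0).2 rfl] at h
  linarith

/-- A norm uniformly close to a function which is approximately linear is itself approximately
linear, in the sense of increments. -/
theorem IsNorm.abs_sub_sub_le {d : ℕ} {N P : (Fin d → ℝ) → ℝ} (hN : IsNorm N)
    (L : (Fin d → ℝ) →L[ℝ] ℝ) {u : Fin d → ℝ} {R η : ℝ} (hR : 0 < R)
    (hP : ∀ x ∈ Metric.ball u R, ∀ y ∈ Metric.ball u R, |P x - P y - L (x - y)| ≤ η * ‖x - y‖)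
    (hNP : ∀ x ∈ Metric.ball u R, |N x - P x| ≤ η * R / 8) {x y : Fin d → ℝ}
    (hx : x ∈ Metric.ball u (R / 2)) (hy : y ∈ Metric.ball u (R / 2)) :
    |N x - N y - L (x - y)| ≤ 2 * η * ‖x - y‖ := by
  have key : ∀ x ∈ Metric.ball u (R / 2), ∀ y ∈ Metric.ball u (R / 2),
      N x - N y - L (x - y) ≤ 2 * η * ‖x - y‖ := by
    intro x hx y hy
    rcases eq_or_ne x y with rfl | hxy
    · simp
    have hτ : 0 < ‖x - y‖ := norm_pos_iff.2 (sub_ne_zero.2 hxy)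
    obtain ⟨t, ht⟩ : ∃ t, t = R / 4 / ‖x - y‖ := ⟨_, rfl⟩
    have ht0 : 0 < t := by rw [ht]; positivity
    have htτ : t * ‖x - y‖ = R / 4 := by rw [ht]; field_simp
    obtain ⟨z, hz⟩ : ∃ z, z = x + t • (x - y) := ⟨_, rfl⟩
    have hzx : z - x = t • (x - y) := by rw [hz]; abel
    have hzx' : ‖z - x‖ = R / 4 := by
      rw [hzx, norm_smul, Real.norm_of_nonneg ht0.le, htτ]
    have hxR : x ∈ Metric.ball u R := Metric.ball_subset_ball (by linarith) hx
    have hzR : z ∈ Metric.ball u R := by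
      rw [Metric.mem_ball] at hx ⊢
      have := dist_triangle z x u
      rw [dist_eq_norm z x, hzx'] at this
      linarith
    have hconv : (1 + t) * N x ≤ N z + t * N y := by
      have h := hN.add_le z (t • y)
      have : z + t • y = (1 + t) • x := by rw [hz, smul_sub, add_smul, one_smul]; abel
      rwa [this, hN.smul, hN.smul, abs_of_pos ht0, abs_of_pos (by linarith)] at h
    have h1 := abs_le.1 (hNP z hzR)
    have h2 := abs_le.1 (hNP x hxR)
    have h3 := abs_le.1 (hP z hzR x hxR)
    rw [hzx', hzx, map_smul, smul_eq_mul] at h3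
    refine le_of_mul_le_mul_left ?_ ht0
    have h4 : t * (2 * η * ‖x - y‖) = η * R / 2 := by
      rw [mul_left_comm, htτ]; ring
    rw [h4]
    linarith
  refine abs_le.2 ⟨?_, key x hx y hy⟩
  have := key y hy x hx
  rw [norm_sub_rev, ← neg_sub x y, map_neg] at this
  linarith

/-- The standard basis, perturbed by a lower triangular matrix. -/
def perturbedBasis {d : ℕ} (ε : Fin d → Fin d → ℝ) (i : Fin d) : Fin d → ℝ :=
  fun k => (Pi.single i 1 : Fin d → ℝ) k + if k < i then ε i k else 0

theorem perturbedBasis_zero {d : ℕ} (i : Fin d) :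
    perturbedBasis (0 : Fin d → Fin d → ℝ) i = Pi.single i 1 := by
  ext k; simp [perturbedBasis]

theorem norm_perturbedBasis_sub_le {d : ℕ} (ε ε' : Fin d → Fin d → ℝ) (i : Fin d) :
    ‖perturbedBasis ε i - perturbedBasis ε' i‖ ≤ ‖ε - ε'‖ := by
  refine (pi_norm_le_iff_of_nonneg (norm_nonneg _)).2 fun k => ?_
  by_cases h : k < i
  · simpa [perturbedBasis, h] using
      (norm_le_pi_norm ((ε - ε') i) k).trans (norm_le_pi_norm (ε - ε') i)
  · simp [perturbedBasis, h]

theorem exists_uniform_radius {d : ℕ} [NeZero d] {p : ℝ} (hp : 1 < p) {η δ : ℝ} (hη : 0 < η)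
    (hδ : 0 < δ) :
    ∃ R, 0 < R ∧ R ≤ δ ∧ ∀ i j : Fin d, i ≠ j →
      (∀ x ∈ Metric.ball (Pi.single i 1 - Pi.single j 1 : Fin d → ℝ) R,
        ∀ y ∈ Metric.ball (Pi.single i 1 - Pi.single j 1 : Fin d → ℝ) R,
        |pNorm p x - pNorm p y - (((2 : ℝ) ^ (1 / p) / 2) • coordDiff i j) (x - y)| ≤ η * ‖x - y‖) ∧
      ∀ x ∈ Metric.ball (Pi.single i 1 - Pi.single j 1 : Fin d → ℝ) R,
        pNorm p x ≤ 2 ^ (1 / p) + 1 := by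
  have hloc : ∀ q : Fin d × Fin d, ∃ R, 0 < R ∧ (q.1 ≠ q.2 →
      (∀ x ∈ Metric.ball (Pi.single q.1 1 - Pi.single q.2 1 : Fin d → ℝ) R,
        ∀ y ∈ Metric.ball (Pi.single q.1 1 - Pi.single q.2 1 : Fin d → ℝ) R,
        |pNorm p x - pNorm p y - (((2 : ℝ) ^ (1 / p) / 2) • coordDiff q.1 q.2) (x - y)| ≤
          η * ‖x - y‖) ∧
      ∀ x ∈ Metric.ball (Pi.single q.1 1 - Pi.single q.2 1 : Fin d → ℝ) R,
        pNorm p x ≤ 2 ^ (1 / p) + 1) := by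
    rintro ⟨i, j⟩
    by_cases hij : i = j
    · exact ⟨1, one_pos, fun h => absurd hij h⟩
    obtain ⟨R₁, hR₁, h₁⟩ := Metric.eventually_nhds_iff_ball.1
      ((hasStrictFDerivAt_pNorm hp hij).isLittleO.def hη)
    have hlt : pNorm p (Pi.single i 1 - Pi.single j 1 : Fin d → ℝ) < 2 ^ (1 / p) + 1 := by
      rw [pNorm_single_sub_single hp hij]; linarith
    obtain ⟨R₂, hR₂, h₂⟩ := Metric.eventually_nhds_iff_ball.1
      ((continuous_pNorm hp).continuousAt.eventually_lt_const hlt)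
    refine ⟨min R₁ R₂, lt_min hR₁ hR₂, fun _ => ⟨fun x hx y hy => ?_, fun x hx =>
      (h₂ x (Metric.ball_subset_ball (min_le_right _ _) hx)).le⟩⟩
    refine h₁ (x, y) ?_
    rw [← ball_prod_same]
    exact ⟨Metric.ball_subset_ball (min_le_left _ _) hx,
      Metric.ball_subset_ball (min_le_left _ _) hy⟩
  choose f hf0 hf using hloc
  obtain ⟨q₀, hq₀⟩ := Finite.exists_min f
  refine ⟨min (f q₀) δ, lt_min (hf0 _) hδ, min_le_right _ _, fun i j hij => ?_⟩
  have hsub := Metric.ball_subset_ball (x := (Pi.single i 1 - Pi.single j 1 : Fin d → ℝ))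
    ((min_le_left (f q₀) δ).trans (hq₀ (i, j)))
  obtain ⟨h1, h2⟩ := hf (i, j) hij
  exact ⟨fun x hx y hy => h1 x (hsub hx) y (hsub hy), fun x hx => h2 x (hsub hx)⟩

/-- For a norm close to the `p`-norm there is an equilateral set close to the standard basis. -/
theorem exists_equilateral_near_basis {d : ℕ} [NeZero d] {p : ℝ} (hp : 1 < p) {δ : ℝ}
    (hδ : 0 < δ) :
    ∃ c : ℝ, 1 < c ∧ ∀ N : (Fin d → ℝ) → ℝ, IsNorm N →
      (∀ x, N x ≤ pNorm p x ∧ pNorm p x ≤ c * N x) →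
      ∃ v : Fin d → Fin d → ℝ, (∀ i j, i ≠ j → N (v i - v j) = 2 ^ (1 / p)) ∧
        ∀ i, ‖v i - Pi.single i 1‖ ≤ δ := by
  obtain ⟨κ, hκ⟩ : ∃ κ : ℝ, κ = 2 ^ (1 / p) / 2 := ⟨_, rfl⟩
  have hκ0 : 0 < κ := by rw [hκ]; positivity
  obtain ⟨R, hR, hRδ, hunif⟩ := exists_uniform_radius (d := d) hp
    (by positivity : 0 < κ / 8) hδ
  rw [← hκ] at hunif
  have hM : 0 < (2 : ℝ) ^ (1 / p) + 1 := by positivity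
  refine ⟨1 + κ / 8 * R / 8 / (2 ^ (1 / p) + 1), by simp; positivity, fun N hN hNP => ?_⟩
  have hclose : ∀ i j : Fin d, i ≠ j →
      ∀ x ∈ Metric.ball (Pi.single i 1 - Pi.single j 1 : Fin d → ℝ) R,
        |N x - pNorm p x| ≤ κ / 8 * R / 8 := by
    intro i j hij x hx
    have h1 := (hunif i j hij).2 x hx
    obtain ⟨h2, h3⟩ := hNP x
    have h4 : κ / 8 * R / 8 / (2 ^ (1 / p) + 1) * N x ≤ κ / 8 * R / 8 := by
      rw [div_mul_eq_mul_div, div_le_iff₀ hM]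
      exact mul_le_mul_of_nonneg_left (h2.trans h1) (by positivity)
    rw [abs_le]
    constructor <;> linarith [show 0 ≤ κ / 8 * R / 8 by positivity]
  set w : (Fin d → Fin d → ℝ) → Fin d → Fin d → Fin d → ℝ :=
    fun ε i j => perturbedBasis ε i - perturbedBasis ε j with hw
  have hwdist : ∀ ε ε' i j, ‖w ε i j - w ε' i j‖ ≤ 2 * ‖ε - ε'‖ := by
    intro ε ε' i j
    have h := norm_sub_le (perturbedBasis ε i - perturbedBasis ε' i)
      (perturbedBasis ε j - perturbedBasis ε' j)
    have h1 := norm_perturbedBasis_sub_le ε ε' i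
    have h2 := norm_perturbedBasis_sub_le ε ε' j
    have : w ε i j - w ε' i j = (perturbedBasis ε i - perturbedBasis ε' i) -
      (perturbedBasis ε j - perturbedBasis ε' j) := by simp only [hw]; abel
    rw [this]
    linarith
  have hw0 : ∀ i j, w 0 i j = Pi.single i 1 - Pi.single j 1 := by
    intro i j; simp only [hw, perturbedBasis_zero]
  have hwball : ∀ ε, ‖ε‖ ≤ R / 8 → ∀ i j,
      w ε i j ∈ Metric.ball (Pi.single i 1 - Pi.single j 1 : Fin d → ℝ) (R / 2) := by
    intro ε hε i j
    have := hwdist ε 0 i j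
    rw [hw0, sub_zero] at this
    rw [Metric.mem_ball, dist_eq_norm]
    linarith
  set T : (Fin d → Fin d → ℝ) → Fin d → Fin d → ℝ :=
    fun ε i j => if j < i then ε i j + (N (w ε i j) - 2 ^ (1 / p)) / κ else 0 with hT
  have hcontr : ∀ ε ε', ‖ε‖ ≤ R / 8 → ‖ε'‖ ≤ R / 8 → ‖T ε - T ε'‖ ≤ 1 / 2 * ‖ε - ε'‖ := by
    intro ε ε' hε hε'
    refine (pi_norm_le_iff_of_nonneg (by positivity)).2 fun i =>
      (pi_norm_le_iff_of_nonneg (by positivity)).2 fun j => ?_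
    by_cases hji : j < i
    · have h1 := hN.abs_sub_sub_le _ hR (hunif i j hji.ne').1 (hclose i j hji.ne')
        (hwball ε hε i j) (hwball ε' hε' i j)
      have hL : (κ • coordDiff i j) (w ε i j - w ε' i j) = -(κ * (ε i j - ε' i j)) := by
        simp [hw, perturbedBasis, hji, hji.not_gt]
        ring
      rw [hL] at h1
      have h2 := hwdist ε ε' i j
      have h3 : (T ε - T ε') i j
          = (N (w ε i j) - N (w ε' i j) - -(κ * (ε i j - ε' i j))) / κ := by
        simp only [Pi.sub_apply, hT, hji, if_true]
        field_simp
        ring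
      rw [h3, Real.norm_eq_abs, abs_div, abs_of_pos hκ0, div_le_iff₀ hκ0]
      nlinarith
    · simp [hT, hji]
  have hT0 : ‖T 0‖ ≤ R / 16 := by
    refine (pi_norm_le_iff_of_nonneg (by positivity)).2 fun i =>
      (pi_norm_le_iff_of_nonneg (by positivity)).2 fun j => ?_
    by_cases hji : j < i
    · have h1 := hclose i j hji.ne' _ (Metric.mem_ball_self hR)
      rw [pNorm_single_sub_single hp hji.ne'] at h1
      simp only [hT, hji, if_true, hw0, Pi.zero_apply, zero_add]
      rw [Real.norm_eq_abs, abs_div, abs_of_pos hκ0, div_le_iff₀ hκ0]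
      nlinarith
    · simp [hT, hji]; positivity
  have hmaps : Set.MapsTo T (Metric.closedBall 0 (R / 8)) (Metric.closedBall 0 (R / 8)) := by
    intro ε hε
    rw [mem_closedBall_zero_iff] at hε ⊢
    have h1 := hcontr ε 0 hε (by simp; positivity)
    rw [sub_zero] at h1
    have h2 := norm_sub_norm_le (T ε) (T 0)
    linarith
  have hcw : ContractingWith (1 / 2) (hmaps.restrict T _ _) := by
    refine ⟨by rw [← NNReal.coe_lt_coe]; norm_num, LipschitzWith.of_dist_le_mul fun x y => ?_⟩
    have := hcontr x y (mem_closedBall_zero_iff.1 x.2) (mem_closedBall_zero_iff.1 y.2)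
    simpa [Subtype.dist_eq, dist_eq_norm] using this
  obtain ⟨ε, hε, hfix, -⟩ := hcw.exists_fixedPoint' Metric.isClosed_closedBall.isComplete hmaps
    (Metric.mem_closedBall_self (by positivity)) (edist_ne_top _ _)
  rw [mem_closedBall_zero_iff] at hε
  have hlow : ∀ i j, j < i → N (w ε i j) = 2 ^ (1 / p) := by
    intro i j hji
    have h := congrFun (congrFun hfix i) j
    simp only [hT, hji, if_true, add_eq_left, div_eq_zero_iff, hκ0.ne', or_false] at h
    linarith
  refine ⟨perturbedBasis ε, fun i j hij => ?_, fun i => ?_⟩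
  · rcases lt_or_gt_of_ne hij with h | h
    · rw [hN.sub_comm]; exact hlow j i h
    · exact hlow i j h
  · have := norm_perturbedBasis_sub_le ε 0 i
    rw [perturbedBasis_zero, sub_zero] at this
    linarith

theorem exists_insert_equilateral {d : ℕ} {N : (Fin d → ℝ) → ℝ} {S : Set (Fin d → ℝ)} {lam : ℝ}
    (hS : NEquilateralWith N S lam) (hnt : S.Nontrivial) (hmax : ¬ NMaximalEquilateral N S) :
    ∃ x, x ∉ S ∧ NEquilateralWith N (insert x S) lam := by
  simp only [NMaximalEquilateral, not_and, not_forall] at hmax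
  obtain ⟨B, ⟨mu, hB⟩, hSB, hne⟩ := hmax ⟨lam, hS⟩
  obtain ⟨x, hxB, hxS⟩ := Set.exists_of_ssubset (hSB.ssubset_of_ne (Ne.symm hne))
  obtain ⟨a, ha, b, hb, hab⟩ := hnt
  have hmu : mu = lam := (hB.2 (hSB ha) (hSB hb) hab).symm.trans (hS.2 ha hb hab)
  subst hmu
  exact ⟨x, hxS, hS.1, hB.2.mono (Set.insert_subset hxB hSB)⟩

/-- The standard basis has no two-point equilateral extension for the `p`-norm. -/
theorem basis_extension_false {d : ℕ} (hd : 3 ≤ d) {p : ℝ} (hp : 1 < p) {x y : Fin d → ℝ}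
    (hx : ∀ i, pNorm p (x - Pi.single i 1) = 2 ^ (1 / p))
    (hy : ∀ i, pNorm p (y - Pi.single i 1) = 2 ^ (1 / p))
    (hxy : pNorm p (x - y) = 2 ^ (1 / p)) : False := by
  have hp0 : p ≠ 0 := by linarith
  have : NeZero d := ⟨by omega⟩
  have hsum : ∀ z : Fin d → ℝ, pNorm p z = 2 ^ (1 / p) → ∑ k, |z k| ^ p = 2 := by
    intro z hz
    rw [← pNorm_rpow hp, hz, ← Real.rpow_mul zero_le_two, one_div_mul_cancel hp0, Real.rpow_one]
  have hdiag : ∀ z : Fin d → ℝ, (∀ i, pNorm p (z - Pi.single i 1) = 2 ^ (1 / p)) →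
      (∀ i, z i = z 0) ∧ |z 0 - 1| ^ p + ((d : ℝ) - 1) * |z 0| ^ p = 2 := by
    intro z hz
    have h1 : ∀ i, (|z i - 1| ^ p - |z i| ^ p) + ∑ k, |z k| ^ p = 2 := by
      intro i
      rw [← hsum _ (hz i), ← eq_sub_iff_add_eq, ← Finset.sum_sub_distrib,
        Finset.sum_eq_single i]
      · simp
      · intro k _ hk; simp [hk]
      · simp
    have h2 : ∀ i, z i = z 0 := fun i =>
      (strictAnti_abs_sub_one_rpow_sub hp).injective (by
        have := h1 i; have := h1 0; linarith)
    refine ⟨h2, ?_⟩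
    have h3 := h1 0
    simp only [h2, Finset.sum_const, Finset.card_univ, Fintype.card_fin, nsmul_eq_mul] at h3
    linarith
  obtain ⟨hx1, hx2⟩ := hdiag x hx
  obtain ⟨hy1, hy2⟩ := hdiag y hy
  have h := hsum _ hxy
  simp only [Pi.sub_apply, hx1, hy1, Finset.sum_const, Finset.card_univ, Fintype.card_fin,
    nsmul_eq_mul] at h
  have hd' : (3 : ℝ) ≤ d := by exact_mod_cast hd
  rcases lt_trichotomy (x 0) (y 0) with hlt | heq | hlt
  · rw [abs_sub_comm, abs_of_pos (sub_pos.2 hlt)] at h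
    exact diagonal_extension_false hp hd' hlt hy2 hx2 h
  · simp [heq, hp0] at h
  · rw [abs_of_pos (sub_pos.2 hlt)] at h
    exact diagonal_extension_false hp hd' hlt hx2 hy2 h

/-- By compactness, approximate two-point extensions of the standard basis yield an exact one. -/
theorem approx_extension_false {d : ℕ} (hd : 3 ≤ d) {p : ℝ} (hp : 1 < p)
    (happ : ∀ δ : ℝ, 0 < δ → ∃ (v : Fin d → Fin d → ℝ) (x y : Fin d → ℝ),
      (∀ i, ‖v i - Pi.single i 1‖ ≤ δ) ∧
      (∀ i, |pNorm p (x - v i) - 2 ^ (1 / p)| ≤ δ) ∧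
      (∀ i, |pNorm p (y - v i) - 2 ^ (1 / p)| ≤ δ) ∧
      |pNorm p (x - y) - 2 ^ (1 / p)| ≤ δ) : False := by
  have : NeZero d := ⟨by omega⟩
  have hpos : ∀ n : ℕ, (0 : ℝ) < 1 / ((n : ℝ) + 1) := fun n => by positivity
  choose v x y hv hx hy hxy using fun n : ℕ => happ _ (hpos n)
  have hle1 : ∀ n : ℕ, 1 / ((n : ℝ) + 1) ≤ 1 := fun n => by
    rw [div_le_one (by positivity)]; linarith [n.cast_nonneg (α := ℝ)]
  have hbdd : ∀ (n : ℕ) (z : Fin d → ℝ),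
      |pNorm p (z - v n 0) - 2 ^ (1 / p)| ≤ 1 / ((n : ℝ) + 1) → ‖z‖ ≤ 2 ^ (1 / p) + 3 := by
    intro n z hz
    have h1 := (norm_le_pNorm hp (z - v n 0))
    have h2 := (abs_le.1 hz).2
    have h3 := hv n 0
    have h4 : ‖(Pi.single 0 1 : Fin d → ℝ)‖ = 1 := by
      rw [Pi.norm_single, norm_one]
    have h5 := norm_sub_norm_le z (v n 0)
    have h6 := norm_sub_norm_le (v n 0) (Pi.single 0 1 : Fin d → ℝ)
    have := hle1 n
    linarith
  obtain ⟨⟨a, b⟩, -, φ, hφ, hlim⟩ := tendsto_subseq_of_bounded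
    (Metric.isBounded_closedBall (x := (0 : (Fin d → ℝ) × (Fin d → ℝ)))
      (r := 2 ^ (1 / p) + 3)) (x := fun n => (x n, y n)) (fun n => by
        rw [mem_closedBall_zero_iff]
        exact max_le (hbdd n _ (hx n 0)) (hbdd n _ (hy n 0)))
  have ha : Filter.Tendsto (fun n => x (φ n)) Filter.atTop (nhds a) :=
    (continuous_fst.tendsto _).comp hlim
  have hb : Filter.Tendsto (fun n => y (φ n)) Filter.atTop (nhds b) :=
    (continuous_snd.tendsto _).comp hlim
  have hzero : Filter.Tendsto (fun n => 1 / ((φ n : ℝ) + 1)) Filter.atTop (nhds 0) :=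
    tendsto_one_div_add_atTop_nhds_zero_nat.comp hφ.tendsto_atTop
  have hvlim : ∀ i, Filter.Tendsto (fun n => v (φ n) i) Filter.atTop
      (nhds (Pi.single i 1)) := fun i =>
    tendsto_iff_norm_sub_tendsto_zero.2
      (squeeze_zero (fun _ => norm_nonneg _) (fun n => hv (φ n) i) hzero)
  have hval : ∀ (z : ℕ → Fin d → ℝ) (c : Fin d → ℝ),
      Filter.Tendsto z Filter.atTop (nhds c) →
      (∀ n, |pNorm p (z n) - 2 ^ (1 / p)| ≤ 1 / ((φ n : ℝ) + 1)) →
      pNorm p c = 2 ^ (1 / p) := by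
    intro z c hz hzn
    refine tendsto_nhds_unique (((continuous_pNorm hp).tendsto c).comp hz) ?_
    exact tendsto_iff_norm_sub_tendsto_zero.2
      (squeeze_zero (fun _ => norm_nonneg _) hzn hzero)
  exact basis_extension_false hd hp
    (fun i => hval _ _ (ha.sub (hvlim i)) fun n => hx (φ n) i)
    (fun i => hval _ _ (hb.sub (hvlim i)) fun n => hy (φ n) i)
    (hval _ _ (ha.sub hb) fun n => hxy (φ n))

/-- Let `p ∈ (1, ∞)` and `d ≥ 3`. There exists `c = c(p,d) > 1` such that
for every norm `N` on `ℝ^d` satisfying `N x ≤ ‖x‖_p ≤ c · N x` for all `x`, the space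
`X = (ℝ^d, N)` satisfies `m(X) ≤ d + 1`. -/
theorem statement5 (p : ℝ) (hp : 1 < p) (d : ℕ) (hd : 3 ≤ d) :
    ∃ c : ℝ, 1 < c ∧
      ∀ N : (Fin d → ℝ) → ℝ, IsNorm N →
        (∀ x : Fin d → ℝ,
          N x ≤ (∑ i, |x i| ^ p) ^ (1 / p) ∧ (∑ i, |x i| ^ p) ^ (1 / p) ≤ c * N x) →
        ∃ A : Set (Fin d → ℝ), NMaximalEquilateral N A ∧ A.Finite ∧ A.ncard ≤ d + 1 := by
  by_contra! hcon
  have : NeZero d := ⟨by omega⟩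
  have hlam : (0 : ℝ) < 2 ^ (1 / p) := by positivity
  refine approx_extension_false hd hp fun δ hδ => ?_
  obtain ⟨c₁, hc₁, hnear⟩ := exists_equilateral_near_basis (d := d) hp hδ
  have hc₂ : 1 < 1 + δ / 2 ^ (1 / p) := by
    have : 0 < δ / 2 ^ (1 / p) := by positivity
    linarith
  obtain ⟨N, hN, hNP, hbad⟩ := hcon (min c₁ (1 + δ / 2 ^ (1 / p))) (lt_min hc₁ hc₂)
  have hNP₁ : ∀ x, N x ≤ pNorm p x ∧ pNorm p x ≤ c₁ * N x := fun x =>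
    ⟨(hNP x).1, (hNP x).2.trans
      (mul_le_mul_of_nonneg_right (min_le_left _ _) (hN.nonneg x))⟩
  have hval : ∀ x, N x = 2 ^ (1 / p) → |pNorm p x - 2 ^ (1 / p)| ≤ δ := by
    intro x hx
    have h1 : N x ≤ pNorm p x := (hNP x).1
    have h2 : pNorm p x ≤ (1 + δ / 2 ^ (1 / p)) * N x := (hNP x).2.trans
      (mul_le_mul_of_nonneg_right (min_le_right _ _) (hN.nonneg x))
    rw [hx] at h1 h2
    rw [add_mul, one_mul, div_mul_cancel₀ _ hlam.ne'] at h2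
    exact abs_le.2 ⟨by linarith, by linarith⟩
  obtain ⟨v, hv, hvδ⟩ := hnear N hN hNP₁
  have hvinj : Function.Injective v := by
    intro i j hij
    by_contra hne
    have := hv i j hne
    rw [hij, sub_self, (hN.eq_zero_iff 0).2 rfl] at this
    exact hlam.ne this
  have hS : NEquilateralWith N (Set.range v) (2 ^ (1 / p)) := by
    refine ⟨hlam, ?_⟩
    rintro _ ⟨i, rfl⟩ _ ⟨j, rfl⟩ hne
    exact hv i j fun h => hne (h ▸ rfl)
  have hfin : (Set.range v).Finite := Set.finite_range v
  have hcard : (Set.range v).ncard = d := by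
    rw [Set.ncard_range_of_injective hvinj, Nat.card_eq_fintype_card, Fintype.card_fin]
  have hnt : (Set.range v).Nontrivial :=
    ⟨v ⟨0, by omega⟩, ⟨_, rfl⟩, v ⟨1, by omega⟩, ⟨_, rfl⟩, fun h => by simpa using hvinj h⟩
  obtain ⟨x, hxS, hx⟩ := exists_insert_equilateral hS hnt fun h => by
    have := hbad _ h hfin
    omega
  obtain ⟨y, hyS, hy⟩ := exists_insert_equilateral hx (hnt.mono (Set.subset_insert _ _))
    fun h => by
      have := hbad _ h (hfin.insert x)
      have := Set.ncard_insert_le x (Set.range v)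
      omega
  have hyx : y ≠ x := fun h => hyS (h ▸ Set.mem_insert _ _)
  refine ⟨v, x, y, hvδ, fun i => hval _ (hx.2 (Set.mem_insert _ _)
    (Set.mem_insert_of_mem _ ⟨i, rfl⟩) fun h => hxS ⟨i, h.symm⟩), fun i => hval _
    (hy.2 (Set.mem_insert _ _) (Set.mem_insert_of_mem _ (Set.mem_insert_of_mem _ ⟨i, rfl⟩))
      fun h => hyS (Set.mem_insert_of_mem _ ⟨i, h.symm⟩)), hval _
    (hy.2 (Set.mem_insert_of_mem _ (Set.mem_insert _ _)) (Set.mem_insert _ _) hyx.symm)⟩
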